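/- Let κ and λ be infinite regular cardinals with λ ≤ κ. Let K and L be uniformly nowhere dense subsets of κ^λ, each of weight at most κ, and let h : K → L be a uniform homeomorphism (with respect to the ultrametrics restricted from κ^λ). Then there exists a uniform auto-homeomorphism H : κ^λ → κ^λ (a bijection such that both H and H⁻¹ are uniformly continuous) with H(x) = h(x) for every x ∈ K. -/

import Mathlib

open Set Function

universe u v

/-- The closed ball of radius `α` and center `x` in an ordinal-valued ultrametric space:
`B_α(x) = {y | u x y ≥ α}`. -/
def Ball {X : Type u} (u : X → X → Ordinal) (α : Ordinal) (x : X) : Set X :=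
  {y | α ≤ u x y}

/-- `u` is a `γ`-ultrametric on `X`: it takes values in `γ + 1` (i.e. values `≤ γ`),
`u x y = γ` iff `x = y`, the ultrametric triangle law, and symmetry. -/
structure IsUltrametric {X : Type u} (γ : Ordinal) (u : X → X → Ordinal) : Prop where
  le_gamma : ∀ x y, u x y ≤ γ
  eq_gamma_iff : ∀ x y, u x y = γ ↔ x = y
  triangle : ∀ x y z, min (u y x) (u x z) ≤ u y z
  symm : ∀ x y, u x y = u y x

/-- The topology induced by a `γ`-ultrametric: the closed balls `B_α(x)`, `α < γ`,
form a base. -/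
def ballTopology {X : Type u} (γ : Ordinal) (u : X → X → Ordinal) : TopologicalSpace X :=
  TopologicalSpace.generateFrom {s : Set X | ∃ x α, α < γ ∧ s = Ball u α x}

/-- `f` is uniformly continuous from the `γX`-ultrametric space `(X, u)` to the
`γY`-ultrametric space `(Y, d)`. -/
def UnifCont {X : Type u} {Y : Type v} (γX γY : Ordinal)
    (u : X → X → Ordinal) (d : Y → Y → Ordinal) (f : X → Y) : Prop :=
  ∀ ε < γY, ∃ δ < γX, ∀ a b, δ ≤ u a b → ε ≤ d (f a) (f b)

/-- A discrete set regarded as a `γ`-ultrametric space. -/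
noncomputable def discreteUltra {X : Type u} (γ : Ordinal) (a b : X) : Ordinal :=
  @ite _ (a = b) (Classical.propDecidable _) γ 0

/-- `A` is uniformly nowhere dense in the `γ`-ultrametric space `(X, u)`. -/
def UnifNwd {X : Type u} (γ : Ordinal) (u : X → X → Ordinal) (A : Set X) : Prop :=
  ∀ α < γ, ∃ β, α < β ∧ β < γ ∧ ∀ b : X, ∃ a ∈ Ball u α b, Ball u β a ∩ A = ∅

/-- The space `κ^λ` of functions from (the ordinals below) `λ` to (the ordinals below) `κ`. -/
def funSpace (κ lam : Cardinal.{0}) : Type 1 :=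
  ↥(Set.Iio lam.ord) → ↥(Set.Iio κ.ord)

/-- The canonical `λ`-ultrametric on `κ^λ`: `u(a,b) = sup {α < λ : a↾α = b↾α}`. -/
noncomputable def funUltra (κ lam : Cardinal.{0}) (a b : funSpace κ lam) : Ordinal :=
  sSup {α : Ordinal | α < lam.ord ∧ ∀ β : ↥(Set.Iio lam.ord), (β : Ordinal) < α → a β = b β}

noncomputable instance (κ lam : Cardinal.{0}) : TopologicalSpace (funSpace κ lam) :=
  ballTopology lam.ord (funUltra κ lam)

/-- The space `X` with topology `t` has weight (least cardinality of a base) at most `c`. -/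
def WeightLE (X : Type u) (t : TopologicalSpace X) (c : Cardinal.{0}) : Prop :=
  ∃ B : Set (Set X), t.IsTopologicalBasis B ∧ Cardinal.mk B ≤ Cardinal.lift.{u} c

section Coding

variable {o : Ordinal.{0}} {A : Type 1}

/-- Two sequences agree below `α`. -/
def AgreeBelow (α : Ordinal.{0}) (a b : Iio o → A) : Prop :=
  ∀ β : Iio o, (β : Ordinal) < α → a β = b β

theorem AgreeBelow.rfl {α : Ordinal.{0}} {a : Iio o → A} : AgreeBelow α a a :=
  fun _ _ => Eq.refl _

theorem AgreeBelow.symm {α : Ordinal.{0}} {a b : Iio o → A} (h : AgreeBelow α a b) :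
    AgreeBelow α b a :=
  fun β hβ => (h β hβ).symm

theorem AgreeBelow.trans {α : Ordinal.{0}} {a b c : Iio o → A} (h : AgreeBelow α a b)
    (h' : AgreeBelow α b c) : AgreeBelow α a c :=
  fun β hβ => (h β hβ).trans (h' β hβ)

theorem AgreeBelow.mono {α α' : Ordinal.{0}} {a b : Iio o → A} (hα : α ≤ α')
    (h : AgreeBelow α' a b) : AgreeBelow α a b :=
  fun β hβ => h β (hβ.trans_le hα)

/-- A compatible family of sequences has a common extension. -/
theorem exists_agreeBelow_of_coherent [Nonempty A] {J : Type 1} [LinearOrder J]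
    (δ : J → Ordinal.{0}) (x : J → Iio o → A)
    (hx : ∀ j k, j ≤ k → AgreeBelow (δ j) (x j) (x k)) :
    ∃ y, ∀ j, AgreeBelow (δ j) y (x j) := by
  classical
  refine ⟨fun β => if h : ∃ j, (β : Ordinal) < δ j then x h.choose β
    else Classical.arbitrary A, fun j β hβ => ?_⟩
  have h : ∃ j, (β : Ordinal) < δ j := ⟨j, hβ⟩
  simp only [dif_pos h]
  rcases le_total h.choose j with hj | hj
  · exact hx _ _ hj β h.choose_spec
  · exact (hx _ _ hj β hβ).symm

variable {K : Type 1} (e : K → Iio o → A) (δ : Iio o → Ordinal.{0}) (G : Iio o → Setoid K)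

/-- `x` lies in the `i`-th neighbourhood of the range of `e`. -/
def IsNear (i : Iio o) (x : Iio o → A) : Prop :=
  ∃ k, AgreeBelow (δ i) (e k) x

/-- The `i`-th partition of the sequence space, extending the partition `G i` of `K`. -/
def SameCell (i : Iio o) (x y : Iio o → A) : Prop :=
  AgreeBelow (δ i) x y ∨
    ∃ k k', AgreeBelow (δ i) (e k) x ∧ AgreeBelow (δ i) (e k') y ∧ (G i) k k'

variable {e δ G}

theorem IsNear.congr {i : Iio o} {x y : Iio o → A} (hxy : AgreeBelow (δ i) x y)
    (h : IsNear e δ i x) : IsNear e δ i y := by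
  obtain ⟨k, hk⟩ := h
  exact ⟨k, hk.trans hxy⟩

theorem SameCell.symm {i : Iio o} {x y : Iio o → A} (h : SameCell e δ G i x y) :
    SameCell e δ G i y x := by
  rcases h with h | ⟨k, k', h, h', hG⟩
  · exact Or.inl h.symm
  · exact Or.inr ⟨k', k, h', h, (G i).symm hG⟩

theorem SameCell.trans (h1 : ∀ i k k', AgreeBelow (δ i) (e k) (e k') → (G i) k k') {i : Iio o}
    {x y z : Iio o → A} (h : SameCell e δ G i x y) (h' : SameCell e δ G i y z) :
    SameCell e δ G i x z := by
  rcases h with h | ⟨k, k', hk, hk', hG⟩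
  · rcases h' with h' | ⟨l, l', hl, hl', hG'⟩
    · exact Or.inl (h.trans h')
    · exact Or.inr ⟨l, l', hl.trans h.symm, hl', hG'⟩
  · rcases h' with h' | ⟨l, l', hl, hl', hG'⟩
    · exact Or.inr ⟨k, k', hk, hk'.trans h', hG⟩
    · exact Or.inr ⟨k, l', hk, hl',
        (G i).trans hG ((G i).trans (h1 i _ _ (hk'.trans hl.symm)) hG')⟩

/-- The partition of the sequence space generated by the partitions of index below `i`. -/
def cellSetoid (h1 : ∀ i k k', AgreeBelow (δ i) (e k) (e k') → (G i) k k') (i : Iio o) :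
    Setoid (Iio o → A) where
  r x y := ∀ j < i, SameCell e δ G j x y
  iseqv :=
    { refl := fun _ _ _ => Or.inl AgreeBelow.rfl
      symm := fun h j hj => (h j hj).symm
      trans := fun h h' j hj => (h j hj).trans h1 (h' j hj) }

/-- Each cell admits a labelling of the balls in it that miss the range of `e`. -/
theorem exists_label (h1 : ∀ i k k', AgreeBelow (δ i) (e k) (e k') → (G i) k k')
    {M : Iio o → Type 1} (ρ : Iio o → Ordinal.{0})
    (hρ : ∀ j i, j < i → δ j ≤ ρ i)
    (hM : ∀ i b, ∃ f : M i → Iio o → A,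
      (∀ m m', AgreeBelow (δ i) (f m) (f m') → m = m') ∧
      ∀ m, AgreeBelow (ρ i) b (f m) ∧ ¬ IsNear e δ i (f m))
    (hg : ∀ i, ∃ g : (Iio o → A) → M i, ∀ x y, g x = g y → AgreeBelow (δ i) x y)
    (i : Iio o) (b : Iio o → A) :
    ∃ p : (Iio o → A) → M i,
      (∀ x y, cellSetoid h1 i b x → cellSetoid h1 i b y → ¬ IsNear e δ i x → ¬ IsNear e δ i y →
        (p x = p y ↔ AgreeBelow (δ i) x y)) ∧
      ∀ m, ∃ x, cellSetoid h1 i b x ∧ ¬ IsNear e δ i x ∧ p x = m := by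
  classical
  let F := {x // cellSetoid h1 i b x ∧ ¬ IsNear e δ i x}
  let s : Setoid F :=
    { r := fun x y => AgreeBelow (δ i) x.1 y.1
      iseqv := ⟨fun _ => AgreeBelow.rfl, fun h => h.symm, fun h h' => h.trans h'⟩ }
  obtain ⟨f, hf, hf'⟩ := hM i b
  obtain ⟨g, hg⟩ := hg i
  let f' : M i → Quotient s := fun m =>
    Quotient.mk s ⟨f m, fun j hj => Or.inl ((hf' m).1.mono (hρ j i hj)), (hf' m).2⟩
  let g' : Quotient s → M i := fun q => g q.out.1
  have hf'i : Function.Injective f' := fun m m' h => hf _ _ (Quotient.exact h)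
  have hg'i : Function.Injective g' := fun q q' h => by
    rw [← q.out_eq, ← q'.out_eq]
    exact Quotient.sound (hg _ _ h)
  obtain ⟨p, hp⟩ := Function.Embedding.schroeder_bernstein hg'i hf'i
  refine ⟨fun x => if hx : cellSetoid h1 i b x ∧ ¬ IsNear e δ i x then p (Quotient.mk s ⟨x, hx⟩)
    else g x, fun x y hx hy hx' hy' => ?_, fun m => ?_⟩
  · simp only [hx, hy, hx', hy', not_false_eq_true, and_self, dif_pos, hp.1.eq_iff]
    exact Quotient.eq
  · obtain ⟨q, rfl⟩ := hp.2 m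
    obtain ⟨⟨x, hx⟩, rfl⟩ := Quotient.exists_rep q
    exact ⟨x, hx.1, hx.2, dif_pos hx⟩

/-- Coding of the sequence space: the points of `Iio o → A` are coded by sequences of cells of `K`
and labels, in such a way that the set of codes does not depend on the embedding `e`. -/
theorem exists_coding [Nonempty A]
    (h1 : ∀ i k k', AgreeBelow (δ i) (e k) (e k') → (G i) k k')
    (h2 : ∀ i k k', (G i) k k' → ∀ j < i, AgreeBelow (δ j) (e k) (e k'))
    (hG : ∀ j i, j ≤ i → ∀ k k', (G i) k k' → (G j) k k')
    (hδ : ∀ j i, j < i → δ j ≤ δ i) {M : Iio o → Type 1} (ρ : Iio o → Ordinal.{0})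
    (hρ : ∀ j i, j < i → δ j ≤ ρ i)
    (hM : ∀ i b, ∃ f : M i → Iio o → A,
      (∀ m m', AgreeBelow (δ i) (f m) (f m') → m = m') ∧
      ∀ m, AgreeBelow (ρ i) b (f m) ∧ ¬ IsNear e δ i (f m))
    (hg : ∀ i, ∃ g : (Iio o → A) → M i, ∀ x y, g x = g y → AgreeBelow (δ i) x y) :
    ∃ c : (Iio o → A) → ∀ i, Quotient (G i) ⊕ M i,
      (∀ k i, c (e k) i = Sum.inl (Quotient.mk _ k)) ∧
      (∀ i x y, AgreeBelow (δ i) x y → ∀ j ≤ i, c x j = c y j) ∧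
      (∀ j i, j < i → ∀ x y, (∀ j' ≤ i, c x j' = c y j') → AgreeBelow (δ j) x y) ∧
      range c = {z | ∀ i k, z i = Sum.inl (Quotient.mk _ k) →
        ∀ j < i, z j = Sum.inl (Quotient.mk _ k)} := by
  classical
  choose p hp hp' using exists_label h1 ρ hρ hM hg
  let rep : Iio o → (Iio o → A) → Iio o → A := fun i x => (Quotient.mk (cellSetoid h1 i) x).out
  have hrep : ∀ i x, cellSetoid h1 i (rep i x) x := fun i x => Quotient.mk_out x
  have hrep' : ∀ i x y, cellSetoid h1 i x y → rep i x = rep i y := fun i x y h =>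
    congrArg Quotient.out (Quotient.sound h)
  let c : (Iio o → A) → ∀ i, Quotient (G i) ⊕ M i := fun x i =>
    if h : IsNear e δ i x then Sum.inl (Quotient.mk _ h.choose) else Sum.inr (p i (rep i x) x)
  have c_near : ∀ i k x, AgreeBelow (δ i) (e k) x → c x i = Sum.inl (Quotient.mk _ k) := by
    intro i k x h
    have hn : IsNear e δ i x := ⟨k, h⟩
    simp only [c, dif_pos hn]
    exact congrArg _ (Quotient.sound (h1 _ _ _ (hn.choose_spec.trans h.symm)))
  have c_far : ∀ i x, ¬ IsNear e δ i x → c x i = Sum.inr (p i (rep i x) x) := fun i x h => by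
    simp only [c, dif_neg h]
  have c_inl : ∀ i k x, c x i = Sum.inl (Quotient.mk _ k) →
      ∃ k', AgreeBelow (δ i) (e k') x ∧ (G i) k' k := by
    intro i k x h
    by_cases hn : IsNear e δ i x
    · obtain ⟨k', hk'⟩ := hn
      rw [c_near i k' x hk'] at h
      exact ⟨k', hk', Quotient.exact (Sum.inl_injective h)⟩
    · rw [c_far i x hn] at h
      cases h
  have c_eq : ∀ i x y, cellSetoid h1 i x y → SameCell e δ G i x y → c x i = c y i := by
    rintro i x y hR (h | ⟨k, k', hk, hk', hkk⟩)
    · by_cases hn : IsNear e δ i x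
      · obtain ⟨k, hk⟩ := hn
        rw [c_near i k x hk, c_near i k y (hk.trans h)]
      · have hn' : ¬ IsNear e δ i y := fun h' => hn (h'.congr h.symm)
        rw [c_far i x hn, c_far i y hn', ← hrep' i x y hR]
        refine congrArg _ ((hp i _ x y (hrep i x) ?_ hn hn').2 h)
        exact (cellSetoid h1 i).trans (hrep i x) hR
    · rw [c_near i k x hk, c_near i k' y hk']
      exact congrArg _ (Quotient.sound hkk)
  have c_cell : ∀ i x y, cellSetoid h1 i x y → c x i = c y i → SameCell e δ G i x y := by
    intro i x y hR h
    by_cases hn : IsNear e δ i x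
    · obtain ⟨k, hk⟩ := hn
      rw [c_near i k x hk] at h
      obtain ⟨k', hk', hkk⟩ := c_inl i k y h.symm
      exact Or.inr ⟨k, k', hk, hk', (G i).symm hkk⟩
    · by_cases hn' : IsNear e δ i y
      · obtain ⟨k, hk⟩ := hn'
        rw [c_near i k y hk, c_far i x hn] at h
        cases h
      · rw [c_far i x hn, c_far i y hn', ← hrep' i x y hR] at h
        exact Or.inl ((hp i _ x y (hrep i x) ((cellSetoid h1 i).trans (hrep i x) hR) hn hn').1
          (Sum.inr_injective h))
  have cell_of_eq : ∀ i x y, (∀ j < i, c x j = c y j) → cellSetoid h1 i x y := by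
    intro i
    induction i using WellFoundedLT.induction with
    | _ i ih =>
      intro x y h j hj
      exact c_cell j x y (ih j hj x y fun j' hj' => h j' (hj'.trans hj)) (h j hj)
  have c_agree : ∀ i x y, AgreeBelow (δ i) x y → ∀ j ≤ i, c x j = c y j := by
    intro i x y h j hj
    have h' : ∀ j ≤ i, SameCell e δ G j x y := fun j hj => by
      rcases hj.eq_or_lt with rfl | hj
      · exact Or.inl h
      · exact Or.inl (h.mono (hδ _ _ hj))
    exact c_eq j x y (fun j' hj' => h' j' (hj'.le.trans hj)) (h' j hj)
  have agree_c : ∀ j i, j < i → ∀ x y, (∀ j' ≤ i, c x j' = c y j') → AgreeBelow (δ j) x y := by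
    intro j i hj x y h
    rcases c_cell i x y (cell_of_eq i x y fun j' hj' => h j' hj'.le) (h i le_rfl) with
      h | ⟨k, k', hk, hk', hkk⟩
    · exact h.mono (hδ _ _ hj)
    · exact ((hk.mono (hδ _ _ hj)).symm.trans (h2 i k k' hkk j hj)).trans (hk'.mono (hδ _ _ hj))
  refine ⟨c, fun k i => c_near i k _ AgreeBelow.rfl, c_agree, agree_c, ?_⟩
  ext z
  constructor
  · rintro ⟨x, rfl⟩ i k h j hj
    obtain ⟨k', hk', hkk⟩ := c_inl i k x h
    rw [c_near j k' x (hk'.mono (hδ _ _ hj))]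
    exact congrArg _ (Quotient.sound (hG _ _ hj.le _ _ hkk))
  · intro hz
    have key : ∀ a : Ordinal.{0}, a ≤ o → ∃ x, ∀ i : Iio o, (i : Ordinal) < a → c x i = z i := by
      intro a
      induction a using WellFoundedLT.induction with
      | _ a ih =>
        intro ha
        rcases Ordinal.zero_or_succ_or_isSuccLimit a with rfl | ⟨a, rfl⟩ | hlim
        · exact ⟨fun _ => Classical.arbitrary A, fun i hi => absurd hi (not_lt_bot)⟩
        · have hao : a < o := (Order.lt_succ a).trans_le ha
          obtain ⟨x, hx⟩ := ih a (Order.lt_succ a) hao.le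
          set i : Iio o := ⟨a, hao⟩
          have aux : ∀ y, c y i = z i → (∀ j < i, c y j = z j) →
              ∀ j : Iio o, (j : Ordinal) < Order.succ a → c y j = z j := by
            intro y hy hy' j hj
            rcases (Order.lt_succ_iff.1 hj).eq_or_lt with h | h
            · have : j = i := Subtype.ext h
              rw [this, hy]
            · exact hy' j h
          rcases hzi : z i with q | m
          · obtain ⟨k, rfl⟩ := Quotient.exists_rep q
            refine ⟨e k, aux _ ?_ fun j hj => ?_⟩
            · rw [hzi, c_near i k _ AgreeBelow.rfl]
            · rw [hz i k hzi j hj, c_near j k _ AgreeBelow.rfl]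
          · obtain ⟨y, hy, hn, hm⟩ := hp' i (rep i x) m
            have hxy : cellSetoid h1 i x y := (cellSetoid h1 i).trans
              ((cellSetoid h1 i).symm (hrep i x)) hy
            refine ⟨y, aux _ ?_ fun j hj => ?_⟩
            · rw [hzi, c_far i y hn, ← hrep' i x y hxy, hm]
            · rw [← hx j hj]
              exact (c_eq j x y (fun j' hj' => hxy j' (hj'.trans hj)) (hxy j hj)).symm
        · have hsucc : ∀ i : Iio o, (i : Ordinal) < a → Order.succ (i : Ordinal) < a :=
            fun i hi => hlim.succ_lt hi
          have : ∀ j : {i : Iio o // (i : Ordinal) < a}, ∃ x, ∀ i : Iio o,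
              (i : Ordinal) ≤ Order.succ (j.1 : Ordinal) → c x i = z i := by
            intro j
            have hj := hsucc ⟨_, (hsucc j.1 j.2).trans_le ha⟩ (hsucc j.1 j.2)
            obtain ⟨x, hx⟩ := ih _ hj (hj.le.trans ha)
            exact ⟨x, fun i hi => hx i (Order.lt_succ_iff.2 hi)⟩
          choose x hx using this
          obtain ⟨y, hy⟩ := exists_agreeBelow_of_coherent (fun j => δ j.1) x (by
            intro j k hjk
            refine agree_c j.1 ⟨_, (hsucc j.1 j.2).trans_le ha⟩ (Order.lt_succ (j.1 : Ordinal)) _ _ ?_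
            intro i hi
            rw [hx j i hi, hx k i (le_trans hi (Order.succ_le_succ hjk))])
          refine ⟨y, fun i hi => ?_⟩
          rw [c_agree i y _ (hy ⟨i, hi⟩) i le_rfl]
          exact hx ⟨i, hi⟩ i (Order.le_succ _)
    obtain ⟨x, hx⟩ := key o le_rfl
    exact ⟨x, funext fun i => hx i i.2⟩

/-- Sequences that agree with `a` below `β` realize all patterns on `[β, β + β)`. -/
theorem exists_spread {β ρ : Ordinal.{0}} (hβ : β + β < o) (hρ : ρ ≤ β) {b a : Iio o → A}
    (hb : AgreeBelow ρ b a) (ha : ∀ k, ¬ AgreeBelow β a (e k)) :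
    ∃ f : (Iio β → A) → Iio o → A,
      (∀ m m', AgreeBelow (β + β) (f m) (f m') → m = m') ∧
      ∀ m, AgreeBelow ρ b (f m) ∧ ¬ ∃ k, AgreeBelow (β + β) (e k) (f m) := by
  classical
  let f : (Iio β → A) → Iio o → A := fun m γ =>
    if h : β ≤ (γ : Ordinal) ∧ (γ : Ordinal) < β + β then
      m ⟨γ - β, Ordinal.sub_lt_of_lt_add h.2 (by simpa using h.1.trans_lt h.2)⟩
    else a γ
  have hf : ∀ m, AgreeBelow β a (f m) := fun m γ hγ => by
    simp only [f, dif_neg (fun h : β ≤ (γ : Ordinal) ∧ _ => h.1.not_gt hγ)]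
  refine ⟨f, fun m m' h => ?_, fun m => ⟨hb.trans ((hf m).mono hρ), ?_⟩⟩
  · ext1 γ
    have hγ : β + (γ : Ordinal) < β + β := (add_lt_add_iff_left β).2 γ.2
    have := h ⟨β + γ, hγ.trans hβ⟩ hγ
    simpa [f, hγ] using this
  · rintro ⟨k, hk⟩
    exact ha k ((hf m).trans (hk.symm.mono (by simp)))

/-- Patterns on `β + β` can be coded by patterns on `β`. -/
theorem exists_compress [Infinite A] {β : Ordinal.{0}} (hβ : β + β < o) :
    ∃ g : (Iio o → A) → Iio β → A, ∀ x y, g x = g y → AgreeBelow (β + β) x y := by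
  obtain ⟨φ⟩ : Nonempty (A × A ≃ A) := Cardinal.eq.1 (by
    rw [← Cardinal.mul_def, Cardinal.mul_eq_self (Cardinal.aleph0_le_mk A)])
  have h1 : ∀ γ : Iio β, β + (γ : Ordinal) < o := fun γ =>
    lt_trans ((add_lt_add_iff_left β).2 γ.2) hβ
  have h0 : ∀ γ : Iio β, (γ : Ordinal) < o := fun γ =>
    (le_add_self : (γ : Ordinal) ≤ β + γ).trans_lt (h1 γ)
  refine ⟨fun x γ => φ (x ⟨γ, h0 γ⟩, x ⟨β + γ, h1 γ⟩), fun x y h γ hγ => ?_⟩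
  have h' : ∀ γ : Iio β, x ⟨γ, h0 γ⟩ = y ⟨γ, h0 γ⟩ ∧ x ⟨β + γ, h1 γ⟩ = y ⟨β + γ, h1 γ⟩ :=
    fun γ => by simpa using congrFun h γ
  rcases lt_or_ge (γ : Ordinal) β with hlt | hge
  · exact (h' ⟨γ, hlt⟩).1
  · obtain ⟨ξ, hξ⟩ := exists_add_of_le hge
    have hξβ : ξ < β := by rw [hξ] at hγ; simpa using hγ
    have : γ = ⟨β + ξ, h1 ⟨ξ, hξβ⟩⟩ := Subtype.ext hξ
    rw [this]
    exact (h' ⟨ξ, hξβ⟩).2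

end Coding

/-- The sequence obtained by iterating `D`, taking suprema of all previous values. -/
noncomputable def supIterate (D : Ordinal.{0} → Ordinal.{0}) (i : Ordinal.{0}) : Ordinal.{0} :=
  D (⨆ j : Iio i, supIterate D j.1)
termination_by i
decreasing_by exact j.2

theorem supIterate_le_iSup (D : Ordinal.{0} → Ordinal.{0}) {i j : Ordinal.{0}} (h : j < i) :
    supIterate D j ≤ ⨆ j : Iio i, supIterate D j.1 :=
  Ordinal.le_iSup (fun j : Iio i => supIterate D j.1) ⟨j, h⟩

theorem iSup_supIterate_lt {c : Cardinal.{0}} (hc : c.IsRegular) {D : Ordinal.{0} → Ordinal.{0}}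
    (hD : ∀ ρ < c.ord, D ρ < c.ord) {i : Ordinal.{0}} (hi : i < c.ord) :
    ⨆ j : Iio i, supIterate D j.1 < c.ord := by
  induction i using WellFoundedLT.induction with
  | _ i ih =>
    refine Ordinal.lift_iSup_lt_of_lt_cof ?_ fun j => ?_
    · rw [← Ordinal.lift_cof, hc.cof_ord, Cardinal.mk_Iio_ordinal]
      rw [Cardinal.lift_id', Cardinal.lift_lt]
      exact Cardinal.lt_ord.1 hi
    · rw [supIterate]
      exact hD _ (ih j j.2 (j.2.trans hi))

theorem le_funUltra_iff {κ lam : Cardinal.{0}} {α : Ordinal.{0}} (hα : α < lam.ord)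
    {a b : funSpace κ lam} : α ≤ funUltra κ lam a b ↔ AgreeBelow α a b := by
  have hbdd : BddAbove {α : Ordinal | α < lam.ord ∧
      ∀ β : ↥(Set.Iio lam.ord), (β : Ordinal) < α → a β = b β} :=
    ⟨lam.ord, fun _ h => h.1.le⟩
  constructor
  · intro h β hβ
    obtain ⟨s, hs, hβs⟩ := exists_lt_of_lt_csSup' (hβ.trans_le h)
    exact hs.2 β hβs
  · exact fun h => le_csSup hbdd ⟨hα, h⟩

theorem UnifNwd.exists_agreeBelow {κ lam : Cardinal.{0}} {A : Set (funSpace κ lam)}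
    (hA : UnifNwd lam.ord (funUltra κ lam) A) {ρ : Ordinal.{0}} (hρ : ρ < lam.ord) :
    ∃ β, ρ < β ∧ β < lam.ord ∧ ∀ b : funSpace κ lam, ∃ a : funSpace κ lam,
      AgreeBelow ρ b a ∧ ∀ k ∈ A, ¬ AgreeBelow β a k := by
  obtain ⟨β, h1, h2, h⟩ := hA ρ hρ
  refine ⟨β, h1, h2, fun b => ?_⟩
  obtain ⟨a, ha, ha'⟩ := h b
  refine ⟨a, (le_funUltra_iff hρ).1 ha, fun k hk hak => ?_⟩
  exact (ha' ▸ ⟨(le_funUltra_iff h2).2 hak, hk⟩ : k ∈ (∅ : Set (funSpace κ lam)))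

/-- Two injections with the same range differ by a bijection of their domains. -/
theorem exists_equiv_of_range_eq {X Y Z : Type*} {f : X → Z} {g : Y → Z} (hf : Injective f)
    (hg : Injective g) (h : range f = range g) : ∃ H : X ≃ Y, ∀ x, g (H x) = f x := by
  refine ⟨(Equiv.ofInjective f hf).trans ((Equiv.setCongr h).trans (Equiv.ofInjective g hg).symm),
    fun x => ?_⟩
  simpa using Equiv.apply_ofInjective_symm hg _

/-- A map compatible with two codings is uniformly continuous. -/
theorem unifCont_of_coding {κ lam : Cardinal.{0}} {T : Iio lam.ord → Type*}
    {δ : Iio lam.ord → Ordinal.{0}} (hδ : ∀ i, δ i < lam.ord)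
    (hδ' : ∀ ε < lam.ord, ∃ j i, j < i ∧ ε ≤ δ j) {c d : funSpace κ lam → ∀ i, T i}
    (hc : ∀ i x y, AgreeBelow (δ i) x y → ∀ j ≤ i, c x j = c y j)
    (hd : ∀ j i, j < i → ∀ x y, (∀ j' ≤ i, d x j' = d y j') → AgreeBelow (δ j) x y)
    {H : funSpace κ lam → funSpace κ lam} (hH : ∀ x, d (H x) = c x) :
    UnifCont lam.ord lam.ord (funUltra κ lam) (funUltra κ lam) H := by
  intro ε hε
  obtain ⟨j, i, hji, hj⟩ := hδ' ε hε
  refine ⟨δ i, hδ i, fun a b hab => ?_⟩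
  rw [le_funUltra_iff (hδ i)] at hab
  rw [le_funUltra_iff hε]
  refine AgreeBelow.mono hj (hd j i hji _ _ fun j' hj' => ?_)
  rw [hH, hH]
  exact hc i a b hab j' hj'

theorem stmt13 (κ lam : Cardinal.{0}) (hκ : κ.IsRegular) (hlam : lam.IsRegular)
    (hle : lam ≤ κ)
    (K L : Set (funSpace κ lam))
    -- `K`, `L` are uniformly nowhere dense subsets of `κ^λ` of weight at most `κ`
    (hKn : UnifNwd lam.ord (funUltra κ lam) K)
    (hLn : UnifNwd lam.ord (funUltra κ lam) L)
    (hwK : WeightLE ↥K instTopologicalSpaceSubtype κ)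
    (hwL : WeightLE ↥L instTopologicalSpaceSubtype κ)
    -- `h` is a uniform homeomorphism of `K` onto `L` (ultrametrics restricted from `κ^λ`)
    (h : ↥K ≃ ↥L)
    (hhu : UnifCont lam.ord lam.ord
      (fun a b : ↥K => funUltra κ lam a.1 b.1)
      (fun a b : ↥L => funUltra κ lam a.1 b.1) h)
    (hhinv : UnifCont lam.ord lam.ord
      (fun a b : ↥L => funUltra κ lam a.1 b.1)
      (fun a b : ↥K => funUltra κ lam a.1 b.1) h.symm) :
    -- there is a uniform auto-homeomorphism `H` of `κ^λ` extending `h`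
    ∃ H : funSpace κ lam ≃ funSpace κ lam,
      UnifCont lam.ord lam.ord (funUltra κ lam) (funUltra κ lam) H ∧
      UnifCont lam.ord lam.ord (funUltra κ lam) (funUltra κ lam) H.symm ∧
      ∀ x : ↥K, H ↑x = ↑(h x) := by
  classical
  have hlim : Order.IsSuccLimit lam.ord := Cardinal.isSuccLimit_ord hlam.aleph0_le
  have hinf : Infinite (Iio κ.ord) := by
    rw [Cardinal.infinite_iff, Cardinal.mk_Iio_ordinal, Cardinal.card_ord,
      Cardinal.aleph0_le_lift]
    exact hκ.aleph0_le
  -- a common modulus for all the hypotheses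
  have hF : ∀ ρ : Ordinal.{0}, ∃ β, ρ < lam.ord → ρ < β ∧ β < lam.ord ∧
      (∀ b : funSpace κ lam, ∃ a : funSpace κ lam,
        AgreeBelow ρ b a ∧ ∀ k : K, ¬ AgreeBelow β a k.1) ∧
      (∀ b : funSpace κ lam, ∃ a : funSpace κ lam,
        AgreeBelow ρ b a ∧ ∀ k : K, ¬ AgreeBelow β a (h k).1) ∧
      (∀ k k' : K, AgreeBelow β k.1 k'.1 → AgreeBelow ρ (h k).1 (h k').1) ∧
      (∀ k k' : K, AgreeBelow β (h k).1 (h k').1 → AgreeBelow ρ k.1 k'.1) := by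
    intro ρ
    by_cases hρ : ρ < lam.ord
    swap
    · exact ⟨0, fun h => absurd h hρ⟩
    obtain ⟨β₁, h1, h1', hβ₁⟩ := hKn.exists_agreeBelow hρ
    obtain ⟨β₂, h2, h2', hβ₂⟩ := hLn.exists_agreeBelow hρ
    obtain ⟨β₃, h3', hβ₃⟩ := hhu ρ hρ
    obtain ⟨β₄, h4', hβ₄⟩ := hhinv ρ hρ
    refine ⟨max (max β₁ β₂) (max β₃ β₄), fun _ => ⟨by simp [h1], by simp [*], fun b => ?_,
      fun b => ?_, fun k k' hk => ?_, fun k k' hk => ?_⟩⟩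
    · obtain ⟨a, ha, ha'⟩ := hβ₁ b
      exact ⟨a, ha, fun k hk => ha' k.1 k.2 (hk.mono (by simp))⟩
    · obtain ⟨a, ha, ha'⟩ := hβ₂ b
      exact ⟨a, ha, fun k hk => ha' _ (h k).2 (hk.mono (by simp))⟩
    · exact (le_funUltra_iff hρ).1 (hβ₃ k k' ((le_funUltra_iff h3').2 (hk.mono (by simp))))
    · have := hβ₄ (h k) (h k') ((le_funUltra_iff h4').2 (hk.mono (by simp)))
      simp only [Equiv.symm_apply_apply] at this
      exact (le_funUltra_iff hρ).1 this
  choose F hF using hF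
  let D : Ordinal.{0} → Ordinal.{0} := fun ρ => F ρ + F ρ
  have hD : ∀ ρ < lam.ord, D ρ < lam.ord := fun ρ hρ =>
    Ordinal.isPrincipal_add_ord hlam.aleph0_le (hF ρ hρ).2.1 (hF ρ hρ).2.1
  let ρ : Iio lam.ord → Ordinal.{0} := fun i => ⨆ j : Iio (i : Ordinal), supIterate D j.1
  let δ : Iio lam.ord → Ordinal.{0} := fun i => supIterate D i
  have hρlt : ∀ i, ρ i < lam.ord := fun i => iSup_supIterate_lt hlam hD i.2
  have hδeq : ∀ i, δ i = F (ρ i) + F (ρ i) := fun i => by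
    change supIterate D i = _
    rw [supIterate]
  have hFδ : ∀ i, F (ρ i) ≤ δ i := fun i => by simp [hδeq]
  have hρF : ∀ i, ρ i ≤ F (ρ i) := fun i => (hF _ (hρlt i)).1.le
  have hδlt : ∀ i, δ i < lam.ord := fun i => by
    rw [hδeq]; exact hD _ (hρlt i)
  have hδρ : ∀ j i, j < i → δ j ≤ ρ i := fun j i hij => supIterate_le_iSup D hij
  have hρmono : ∀ j i, j ≤ i → ρ j ≤ ρ i := fun j i hij => by
    rcases hij.eq_or_lt with rfl | hij
    · exact le_rfl
    · exact ((hρF j).trans (hFδ j)).trans (hδρ j i hij)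
  have hδδ : ∀ j i, j < i → δ j < δ i := fun j i hij =>
    (hδρ j i hij).trans_lt ((hF _ (hρlt i)).1.trans_le (hFδ i))
  have hδid : ∀ i : Iio lam.ord, (i : Ordinal) ≤ δ i := by
    intro i
    induction i using WellFoundedLT.induction with
    | _ i ih =>
      refine le_of_forall_lt fun a ha => ?_
      exact (ih ⟨a, ha.trans i.2⟩ ha).trans_lt (hδδ _ _ ha)
  have hδ' : ∀ ε < lam.ord, ∃ j i, j < i ∧ ε ≤ δ j := fun ε hε =>
    ⟨⟨ε, hε⟩, ⟨Order.succ ε, hlim.succ_lt hε⟩, Order.lt_succ ε, hδid ⟨ε, hε⟩⟩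
  let G : Iio lam.ord → Setoid K := fun i =>
    { r := fun k k' => AgreeBelow (ρ i) k.1 k'.1 ∧ AgreeBelow (ρ i) (h k).1 (h k').1
      iseqv := ⟨fun _ => ⟨AgreeBelow.rfl, AgreeBelow.rfl⟩, fun h => ⟨h.1.symm, h.2.symm⟩,
        fun h h' => ⟨h.1.trans h'.1, h.2.trans h'.2⟩⟩ }
  have hG : ∀ j i, j ≤ i → ∀ k k', (G i) k k' → (G j) k k' := fun j i hij k k' hk =>
    ⟨hk.1.mono (hρmono j i hij), hk.2.mono (hρmono j i hij)⟩
  have hM : ∀ e : K → funSpace κ lam, (∀ i b, ∃ a : funSpace κ lam,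
      AgreeBelow (ρ i) b a ∧ ∀ k : K, ¬ AgreeBelow (F (ρ i)) a (e k)) →
      ∀ i b, ∃ f : (Iio (F (ρ i)) → Iio κ.ord) → funSpace κ lam,
      (∀ m m', AgreeBelow (δ i) (f m) (f m') → m = m') ∧
      ∀ m, AgreeBelow (ρ i) b (f m) ∧ ¬ IsNear e δ i (f m) := by
    intro e he i b
    obtain ⟨a, ha, ha'⟩ := he i b
    simp only [IsNear, hδeq]
    exact exists_spread (hD _ (hρlt i)) (hρF i) ha ha'
  have hg : ∀ i, ∃ g : funSpace κ lam → (Iio (F (ρ i)) → Iio κ.ord),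
      ∀ x y, g x = g y → AgreeBelow (δ i) x y := by
    intro i
    rw [hδeq]
    exact exists_compress (hD _ (hρlt i))
  obtain ⟨c, hc, hc', hc'', hcr⟩ := exists_coding (e := fun k : K => k.1) (δ := δ) (G := G)
    (fun i k k' hk => ⟨hk.mono ((hρF i).trans (hFδ i)),
      (hF _ (hρlt i)).2.2.2.2.1 k k' (hk.mono (hFδ i))⟩)
    (fun i k k' hk j hj => hk.1.mono (hδρ j i hj)) hG (fun j i hij => (hδδ j i hij).le) ρ hδρ
    (hM _ fun i => (hF _ (hρlt i)).2.2.1) hg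
  obtain ⟨d, hd, hd', hd'', hdr⟩ := exists_coding (e := fun k : K => (h k).1) (δ := δ) (G := G)
    (fun i k k' hk => ⟨(hF _ (hρlt i)).2.2.2.2.2 k k' (hk.mono (hFδ i)),
      hk.mono ((hρF i).trans (hFδ i))⟩)
    (fun i k k' hk j hj => hk.2.mono (hδρ j i hj)) hG (fun j i hij => (hδδ j i hij).le) ρ hδρ
    (hM _ fun i => (hF _ (hρlt i)).2.2.2.1) hg
  have inj : ∀ c : funSpace κ lam → ∀ i, Quotient (G i) ⊕ (Iio (F (ρ i)) → Iio κ.ord),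
      (∀ j i, j < i → ∀ x y, (∀ j' ≤ i, c x j' = c y j') → AgreeBelow (δ j) x y) →
      Injective c := by
    intro c hc x y hxy
    funext β
    obtain ⟨j, i, hji, hj⟩ := hδ' _ (hlim.succ_lt β.2)
    exact hc j i hji x y (fun j' _ => congrFun hxy j') β (Order.succ_le_iff.1 hj)
  obtain ⟨H, hH⟩ := exists_equiv_of_range_eq (inj c hc'') (inj d hd'') (hcr.trans hdr.symm)
  refine ⟨H, unifCont_of_coding hδlt hδ' hc' hd'' hH,
    unifCont_of_coding hδlt hδ' hd' hc'' fun y => ?_, fun x => inj d hd'' ?_⟩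
  · rw [← hH, Equiv.apply_symm_apply]
  · rw [hH]
    funext i
    rw [hc, hd]
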